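/- arXiv:1809.00122 — 2 statements merged into one kernel-verified Lean document; each statement's English description precedes it below -/
import Mathlib

section
/- For every nonnegative integer n, \binom{3n-1}{n} = \sum_{l=1}^{n} 2^l \sum_{k_1+\cdots+k_l=n,\, k_i\ge 1} F_{k_1} F_{k_2} \cdots F_{k_l}, where F_k = \binom{3k}{k}/(2k+1) are the Fuss–Catalan numbers (for n\ge 1). -/
open PowerSeries

/-- The coefficients `r / (r + (s + 1) n) * binom(r + (s + 1) n, n)` of the `r`-th power of the
Fuss–Catalan series `B = 1 + X * B ^ (s + 1)`. -/
def raneyNumber (s r : ℕ) : ℕ → ℚ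
  | 0 => 1
  | n + 1 => r / (n + 1) * (r + (s + 1) * n + s).choose n

theorem raneyNumber_succ_right (s r n : ℕ) :
    raneyNumber s (r + 1) (n + 1) =
      raneyNumber s r (n + 1) + raneyNumber s (r + (s + 1)) n := by
  cases n with
  | zero => simp [raneyNumber]
  | succ n =>
    simp only [raneyNumber]
    obtain ⟨N, hN⟩ : ∃ N, N = r + (s + 1) * (n + 1) + s := ⟨_, rfl⟩
    rw [show r + 1 + (s + 1) * (n + 1) + s = N + 1 by rw [hN]; ring,
      show r + (s + 1) + (s + 1) * n + s = N by rw [hN]; ring, ← hN, Nat.choose_succ_succ]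
    have hle : n ≤ N := by rw [hN]; nlinarith
    have h : (N.choose (n + 1) : ℚ) * (n + 1) = N.choose n * (N - n) := by
      have := Nat.choose_succ_right_eq N n
      rw [← Nat.cast_sub hle]
      exact_mod_cast this
    have hNq : (N : ℚ) = r + (s + 1) * (n + 1) + s := by exact_mod_cast hN
    rw [hNq] at h
    push_cast
    field_simp
    linear_combination h

theorem mk_raneyNumber_succ (s r : ℕ) :
    PowerSeries.mk (raneyNumber s (r + 1)) =
      PowerSeries.mk (raneyNumber s r) + X * PowerSeries.mk (raneyNumber s (r + (s + 1))) := by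
  ext n
  cases n with
  | zero => simp [raneyNumber]
  | succ n => simp [coeff_succ_X_mul, raneyNumber_succ_right]

theorem mk_raneyNumber_zero (s : ℕ) : PowerSeries.mk (raneyNumber s 0) = 1 := by
  ext n
  cases n <;> simp [raneyNumber, coeff_one]

/-- The Rothe–Hagen identity, in terms of generating functions. -/
theorem mk_raneyNumber_mul_mk_choose (s r : ℕ) :
    PowerSeries.mk (raneyNumber s r) *
        PowerSeries.mk (fun n ↦ (((s + 1) * n).choose n : ℚ)) =
      PowerSeries.mk fun n ↦ (((s + 1) * n + r).choose n : ℚ) := by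
  ext n
  induction n generalizing r with
  | zero => simp [raneyNumber]
  | succ n ihn =>
    induction r with
    | zero => simp [mk_raneyNumber_zero]
    | succ r ihr =>
      rw [mk_raneyNumber_succ, add_mul, map_add, ihr, mul_assoc, coeff_succ_X_mul, ihn]
      simp only [coeff_mk]
      rw [show (s + 1) * (n + 1) + (r + 1) = (s + 1) * (n + 1) + r + 1 by ring,
        Nat.choose_succ_succ,
        show (s + 1) * n + (r + (s + 1)) = (s + 1) * (n + 1) + r by ring]
      push_cast
      ring

/-- The coefficients of a power of a series without constant term are sums over compositions. -/
theorem coeff_mk_ite_pow {R : Type*} [CommSemiring R] (F : ℕ → R) (l n : ℕ) :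
    coeff n (PowerSeries.mk (fun k ↦ if 1 ≤ k then F k else 0) ^ l) =
      ∑ k ∈ (Finset.Nat.antidiagonalTuple l n).filter (fun k => ∀ i, 1 ≤ k i),
        ∏ i, F (k i) := by
  have h := coeff_prod (fun _ : Fin l ↦ PowerSeries.mk (fun k ↦ if 1 ≤ k then F k else 0)) n
    Finset.univ
  rw [Finset.prod_const, Finset.card_univ, Fintype.card_fin] at h
  rw [h, Finset.sum_filter]
  refine Finset.sum_equiv Finsupp.equivFunOnFinite (fun k ↦ ?_) fun k _ ↦ ?_
  · simp [Finset.Nat.mem_antidiagonalTuple]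
  · simp only [coeff_mk, Finsupp.equivFunOnFinite_apply]
    split_ifs with hk
    · exact Finset.prod_congr rfl fun i _ ↦ if_pos (hk i)
    · push Not at hk
      obtain ⟨i, hi⟩ := hk
      exact Finset.prod_eq_zero (Finset.mem_univ i) (if_neg hi.not_ge)

theorem raneyNumber_two_one (n : ℕ) :
    raneyNumber 2 1 n = ((3 * n).choose n : ℚ) / (2 * n + 1) := by
  cases n with
  | zero => simp [raneyNumber]
  | succ n =>
    simp only [raneyNumber]
    have h₃ := Nat.choose_succ_right_eq (3 * n + 3) n
    rw [show 3 * n + 3 - n = 2 * n + 3 by omega] at h₃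
    rw [show 1 + (2 + 1) * n + 2 = 3 * n + 2 + 1 by ring, show 3 * (n + 1) = 3 * n + 3 by ring]
    have h₃' : ((3 * n + 3).choose (n + 1) : ℚ) * (n + 1) =
      (3 * n + 3).choose n * (2 * n + 3) := by exact_mod_cast h₃
    push_cast
    field_simp
    linear_combination -h₃'

theorem two_mul_choose_three_mul_add_one (n : ℕ) :
    (2 : ℚ) * (3 * n + 1).choose n =
      3 * (3 * n).choose n - (3 * n).choose n / (2 * n + 1) := by
  have h := Nat.choose_mul_succ_eq (3 * n) n
  rw [show 3 * n + 1 - n = 2 * n + 1 by omega] at h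
  have h' : ((3 * n).choose n : ℚ) * (3 * n + 1) = (3 * n + 1).choose n * (2 * n + 1) := by
    exact_mod_cast h
  field_simp
  linear_combination -2 * h'

theorem three_mul_choose_three_mul_sub_one {n : ℕ} (hn : n ≠ 0) :
    (3 : ℚ) * (3 * n - 1).choose n = 2 * (3 * n).choose n := by
  obtain ⟨m, rfl⟩ := Nat.exists_eq_succ_of_ne_zero hn
  have h := Nat.choose_mul_succ_eq (3 * m + 2) (m + 1)
  rw [show 3 * m + 2 + 1 - (m + 1) = 2 * (m + 1) by omega] at h
  rw [show 3 * m.succ - 1 = 3 * m + 2 by omega, show 3 * m.succ = 3 * m + 2 + 1 by omega]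
  have h' : ((3 * m + 2).choose (m + 1) : ℚ) * (3 * (m + 1)) =
      (3 * m + 2 + 1).choose (m + 1) * (2 * (m + 1)) := by exact_mod_cast h
  refine mul_right_cancel₀ (b := (m + 1 : ℚ)) (by positivity) ?_
  linear_combination h'

/-- The generating function of `binom(3n - 1, n)` is `1 / (3 - 2 * B)`, where `B` is the
Fuss–Catalan series. -/
theorem mk_choose_three_mul_sub_one_mul :
    PowerSeries.mk (fun n ↦ ((3 * n - 1).choose n : ℚ)) *
      (3 - 2 * PowerSeries.mk (raneyNumber 2 1)) = 1 := by
  have h₁ : 2 * PowerSeries.mk (fun n ↦ ((3 * n + 1).choose n : ℚ)) =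
      3 * PowerSeries.mk (fun n ↦ ((3 * n).choose n : ℚ)) -
        PowerSeries.mk (raneyNumber 2 1) := by
    ext n
    simpa [← map_ofNat (C (R := ℚ)), coeff_C_mul, raneyNumber_two_one] using
      two_mul_choose_three_mul_add_one n
  have h₂ : 3 * PowerSeries.mk (fun n ↦ ((3 * n - 1).choose n : ℚ)) =
      2 * PowerSeries.mk (fun n ↦ ((3 * n).choose n : ℚ)) + 1 := by
    ext n
    rcases eq_or_ne n 0 with rfl | hn
    · simp [← map_ofNat (C (R := ℚ)), coeff_C_mul]
      norm_num
    · simpa [← map_ofNat (C (R := ℚ)), coeff_C_mul, coeff_one, hn] using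
        three_mul_choose_three_mul_sub_one hn
  have h₃ := mk_raneyNumber_mul_mk_choose 2 1
  norm_num only at h₃
  have h_three : (3 : ℚ⟦X⟧) ≠ 0 := by
    rw [← map_ofNat (C (R := ℚ)), Ne, map_eq_zero_iff _ C_injective]
    norm_num
  refine mul_left_cancel₀ h_three ?_
  linear_combination (3 - 2 * PowerSeries.mk (raneyNumber 2 1)) * h₂ - 4 * h₃ - 2 * h₁

/-- For every `n ≥ 1`,
`binom(3n-1, n) = ∑_{l=1}^{n} 2^l ∑_{k₁+⋯+k_l = n, kᵢ ≥ 1} F_{k₁} ⋯ F_{k_l}`,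
where `F_k = binom(3k,k)/(2k+1)` are the Fuss–Catalan numbers. -/
theorem stmt_5 (F : ℕ → ℚ) (hF : ∀ k, F k = (Nat.choose (3 * k) k : ℚ) / (2 * k + 1)) :
    ∀ n : ℕ, 1 ≤ n →
      (Nat.choose (3 * n - 1) n : ℚ) =
        ∑ l ∈ Finset.Icc 1 n, (2 : ℚ) ^ l *
          ∑ k ∈ (Finset.Nat.antidiagonalTuple l n).filter (fun k => ∀ i, 1 ≤ k i),
            ∏ i, F (k i) := by
  intro n hn
  simp_rw [← coeff_mk_ite_pow]
  set f : ℚ⟦X⟧ := PowerSeries.mk fun k ↦ if 1 ≤ k then F k else 0 with hf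
  set G : ℚ⟦X⟧ := PowerSeries.mk fun n ↦ ((3 * n - 1).choose n : ℚ) with hG
  have hB : PowerSeries.mk (raneyNumber 2 1) = 1 + f := by
    ext k
    rcases Nat.eq_zero_or_pos k with rfl | hk
    · simp [hf, raneyNumber]
    · simp [hf, raneyNumber_two_one, hF, coeff_one, hk.ne', Nat.one_le_iff_ne_zero]
  have hGf : G * (1 - 2 * f) = 1 := by
    have h := mk_choose_three_mul_sub_one_mul
    rw [hB] at h
    linear_combination h
  have hgeom : ∑ l ∈ Finset.range (n + 1), (2 * f) ^ l = G - f ^ (n + 1) * (2 ^ (n + 1) * G) := by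
    have h := geom_sum_mul_neg (2 * f) (n + 1)
    rw [mul_pow] at h
    linear_combination G * h - (∑ l ∈ Finset.range (n + 1), (2 * f) ^ l) * hGf
  have hdvd : X ^ (n + 1) ∣ f ^ (n + 1) * (2 ^ (n + 1) * G) :=
    Dvd.dvd.mul_right (pow_dvd_pow_of_dvd (X_dvd_iff.2 (by simp [hf])) _) _
  have hcoeff := congrArg (coeff n) hgeom
  rw [map_sub, X_pow_dvd_iff.1 hdvd n n.lt_succ_self, sub_zero, hG, coeff_mk, map_sum,
    Finset.range_eq_Ico, Finset.sum_eq_sum_Ico_succ_bot n.succ_pos, pow_zero, coeff_one,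
    if_neg (by omega), zero_add] at hcoeff
  rw [← hcoeff]
  refine Finset.sum_congr (by ext; simp) fun l _ ↦ ?_
  rw [mul_pow, ← map_ofNat (C (R := ℚ)), ← map_pow, coeff_C_mul]
end

section
/- If u is a meromorphic solution of u'' = (u')^2/u - u'/\tau + (-8u^2 + 2ab)/\tau + b^2/u with a pole at \tau_p \ne 0, then the pole has order exactly 2 and the leading Laurent coefficient is -\tau_p/4, i.e., u(\tau) = -\frac{\tau_p}{4(\tau-\tau_p)^2} + O((\tau-\tau_p)^{-1}). -/
open Filter Topology

theorem hasDerivAt_div_sub_pow {f : ℂ → ℂ} {f' z p : ℂ} (n : ℕ) (hf : HasDerivAt f f' z)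
    (hz : z ≠ p) :
    HasDerivAt (fun w => f w / (w - p) ^ n) ((f' * (z - p) - n * f z) / (z - p) ^ (n + 1)) z := by
  have hx : z - p ≠ 0 := sub_ne_zero.mpr hz
  have hpow := ((hasDerivAt_id z).sub_const p).fun_pow n
  refine (hf.fun_div hpow (pow_ne_zero n hx)).congr_deriv ?_
  rcases n with _ | m
  · simp [hx]
  · simp only [id, Nat.add_sub_cancel]
    push_cast
    field_simp
    ring

theorem eventually_deriv_eq_of_eq_div_sub_pow {v f : ℂ → ℂ} {p : ℂ} (n : ℕ)
    (hf : AnalyticAt ℂ f p) (hv : ∀ᶠ z in 𝓝[≠] p, v z = f z / (z - p) ^ n) :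
    ∀ᶠ z in 𝓝[≠] p, deriv v z = (deriv f z * (z - p) - n * f z) / (z - p) ^ (n + 1) := by
  have hd : deriv v =ᶠ[𝓝[≠] p] deriv fun w => f w / (w - p) ^ n :=
    EventuallyEq.nhdsNE_deriv hv
  filter_upwards [hd, hf.eventually_analyticAt.filter_mono nhdsWithin_le_nhds,
    self_mem_nhdsWithin] with z hz hfz hne
  rw [hz, (hasDerivAt_div_sub_pow n hfz.differentiableAt.hasDerivAt hne).deriv]

theorem eq_of_eventually_nhdsNE_eq {f h : ℂ → ℂ} {p : ℂ} (hf : ContinuousAt f p)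
    (hh : ContinuousAt h p) (heq : ∀ᶠ z in 𝓝[≠] p, f z = h z) : f p = h p :=
  tendsto_nhds_unique_of_eventuallyEq (hf.tendsto.mono_left nhdsWithin_le_nhds)
    (hh.tendsto.mono_left nhdsWithin_le_nhds) heq



/-- If `u` is a meromorphic solution of
`u'' = (u')²/u - u'/τ + (-8u² + 2ab)/τ + b²/u` (written below in the equivalent form
obtained by multiplying through by `τ·u`) with a pole at `τ_p ≠ 0`, i.e.
`u(τ) = g(τ)/(τ - τ_p)ⁿ` near `τ_p` with `g` analytic, `g(τ_p) ≠ 0`, `n ≥ 1`,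
then the pole has order exactly `2` and the leading Laurent coefficient is `-τ_p/4`:
`u(τ) = -τ_p/(4(τ-τ_p)²) + O((τ-τ_p)⁻¹)`. -/
theorem stmt_11 (a b : ℂ) (τp : ℂ) (hτp : τp ≠ 0) (u g : ℂ → ℂ) (n : ℕ) (hn : 1 ≤ n)
    (hg : AnalyticAt ℂ g τp) (hg0 : g τp ≠ 0)
    (hrep : ∀ᶠ τ in 𝓝[≠] τp, u τ = g τ / (τ - τp) ^ n)
    (hODE : ∀ᶠ τ in 𝓝[≠] τp,
      τ * u τ * deriv (deriv u) τ =
        τ * (deriv u τ) ^ 2 - u τ * deriv u τ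
          + u τ * (-8 * (u τ) ^ 2 + 2 * a * b) + τ * b ^ 2) :
    n = 2 ∧ g τp = -τp / 4 := by
  have hu' := eventually_deriv_eq_of_eq_div_sub_pow n hg hrep
  have hg' := hg.deriv
  have hg'' := hg'.deriv
  have hsub : AnalyticAt ℂ (fun z => z - τp) τp := by fun_prop
  have hu'' := eventually_deriv_eq_of_eq_div_sub_pow (n + 1)
    ((hg'.fun_mul hsub).fun_sub (analyticAt_const.fun_mul hg)) hu'
  have key : ∀ᶠ z in 𝓝[≠] τp,
      (z - τp) ^ n * (z * ((g z * deriv (deriv g) z - deriv g z ^ 2) * (z - τp) ^ 2 + n * g z ^ 2)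
        + g z * (deriv g z * (z - τp) - n * g z) * (z - τp)) =
      (z - τp) ^ 2 * (-8 * g z ^ 3 + 2 * a * b * g z * (z - τp) ^ (2 * n)
        + z * b ^ 2 * (z - τp) ^ (3 * n)) := by
    filter_upwards [hrep, hu', hu'', hODE, hg.eventually_analyticAt.filter_mono nhdsWithin_le_nhds,
      self_mem_nhdsWithin] with z h0 h1 h2 hode hgz hne
    have hx : z - τp ≠ 0 := sub_ne_zero.mpr hne
    have hnum : deriv (fun w => deriv g w * (w - τp) - n * g w) z =
        deriv (deriv g) z * (z - τp) + deriv g z - n * deriv g z := by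
      have hA := hgz.deriv.differentiableAt.hasDerivAt.fun_mul
        ((hasDerivAt_id z).sub_const τp)
      have hB := hgz.differentiableAt.hasDerivAt.const_mul (n : ℂ)
      simpa using (hA.fun_sub hB).deriv
    rw [hnum] at h2
    rw [h0, h1, h2] at hode
    generalize z - τp = x at *
    generalize deriv (deriv g) z = g₂ at *
    generalize deriv g z = g₁ at *
    generalize g z = g₀ at *
    have hxn : x ^ n ≠ 0 := pow_ne_zero n hx
    simp only [pow_succ x, pow_mul', Nat.cast_add, Nat.cast_one] at hode ⊢
    generalize x ^ n = y at *
    field_simp at hode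
    linear_combination hode
  have hc := hg.continuousAt
  have hc' := hg'.continuousAt
  have hc'' := hg''.continuousAt
  obtain rfl | rfl | ⟨m, rfl⟩ : n = 1 ∨ n = 2 ∨ ∃ m, n = m + 3 := by
    rcases n with _ | _ | _ | m <;> simp_all
  · exfalso
    have h := eq_of_eventually_nhdsNE_eq (p := τp)
      (f := fun z => z * ((g z * deriv (deriv g) z - deriv g z ^ 2) * (z - τp) ^ 2 + g z ^ 2)
        + g z * (deriv g z * (z - τp) - g z) * (z - τp))
      (h := fun z => (z - τp) * (-8 * g z ^ 3 + 2 * a * b * g z * (z - τp) ^ 2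
        + z * b ^ 2 * (z - τp) ^ 3)) (by fun_prop) (by fun_prop) (by
        filter_upwards [key, self_mem_nhdsWithin] with z hz hne
        refine mul_left_cancel₀ (sub_ne_zero.mpr hne) ?_
        push_cast at hz
        linear_combination hz)
    simp [hτp, hg0] at h
  · have h := eq_of_eventually_nhdsNE_eq (p := τp)
      (f := fun z => z * ((g z * deriv (deriv g) z - deriv g z ^ 2) * (z - τp) ^ 2 + 2 * g z ^ 2)
        + g z * (deriv g z * (z - τp) - 2 * g z) * (z - τp))
      (h := fun z => -8 * g z ^ 3 + 2 * a * b * g z * (z - τp) ^ 4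
        + z * b ^ 2 * (z - τp) ^ 6) (by fun_prop) (by fun_prop) (by
        filter_upwards [key, self_mem_nhdsWithin] with z hz hne
        refine mul_left_cancel₀ (pow_ne_zero 2 (sub_ne_zero.mpr hne)) ?_
        push_cast at hz
        linear_combination hz)
    simp only [sub_self] at h
    refine ⟨rfl, mul_left_cancel₀ (pow_ne_zero 2 hg0) ?_⟩
    linear_combination (1 / 8 : ℂ) * h
  · exfalso
    have h := eq_of_eventually_nhdsNE_eq (p := τp)
      (f := fun z => (z - τp) ^ (m + 1) *
        (z * ((g z * deriv (deriv g) z - deriv g z ^ 2) * (z - τp) ^ 2 + (m + 3) * g z ^ 2)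
        + g z * (deriv g z * (z - τp) - (m + 3) * g z) * (z - τp)))
      (h := fun z => -8 * g z ^ 3 + 2 * a * b * g z * (z - τp) ^ (2 * (m + 3))
        + z * b ^ 2 * (z - τp) ^ (3 * (m + 3))) (by fun_prop) (by fun_prop) (by
        filter_upwards [key, self_mem_nhdsWithin] with z hz hne
        refine mul_left_cancel₀ (pow_ne_zero 2 (sub_ne_zero.mpr hne)) ?_
        push_cast at hz
        linear_combination hz)
    simp [hg0] at h
end
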